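/- arXiv:2310.18093 — 4 statements merged into one kernel-verified Lean document; each statement's English description precedes it below -/
import Mathlib

section
/- For every real d > 0, every integer k ≥ 0, every real μ, and every u with 0 < u < 1, the function H(u) = u^(k/2) · φ(u), where φ(u) = ∑_{n=0}^∞ (∏_{j=0}^{n-1} ((k/2 + j)² + μ²)) · uⁿ / ((∏_{j=0}^{n-1} (1 + k + j)) · n!), satisfies the hypergeometric-type ordinary differential equation u(1−u)·H''(u) + (1−u)·H'(u) − (k²/4)·H(u)/u − μ²·H(u) = 0. -/
/-- The real-valued form of the Gauss hypergeometric function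
`₂F₁(k/2 + iμ, k/2 − iμ; 1 + k; u)`:
`φ(u) = ∑_{n=0}^∞ (∏_{j=0}^{n-1} ((k/2 + j)² + μ²)) · uⁿ / ((∏_{j=0}^{n-1} (1 + k + j)) · n!)`. -/
noncomputable def phiHyp (k : ℕ) (μ : ℝ) (u : ℝ) : ℝ :=
  ∑' n : ℕ, (∏ j ∈ Finset.range n, (((k : ℝ) / 2 + (j : ℝ)) ^ 2 + μ ^ 2)) * u ^ n /
    ((∏ j ∈ Finset.range n, (1 + (k : ℝ) + (j : ℝ))) * (n.factorial : ℝ))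

/-- `H(u) = u^(k/2) · φ(u)` (real power). -/
noncomputable def Hhyp (k : ℕ) (μ : ℝ) (u : ℝ) : ℝ :=
  u ^ ((k : ℝ) / 2) * phiHyp k μ u

open Filter Topology

/-- A power series whose coefficient ratios tend to `1` converges on the open unit ball. -/
lemma summable_pow_of_ratio {a q : ℕ → ℝ} (hq : Tendsto q atTop (𝓝 1))
    (ha : ∀ n, a (n + 1) = q n * a n) {u : ℝ} (hu : |u| < 1) :
    Summable fun n => a n * u ^ n := by
  obtain ⟨r, hur, hr⟩ := exists_between hu
  have hlim : Tendsto (fun n => |q n| * |u|) atTop (𝓝 |u|) := by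
    simpa using hq.abs.mul_const |u|
  refine summable_of_ratio_norm_eventually_le hr ?_
  filter_upwards [hlim.eventually_le_const hur] with n hn
  calc ‖a (n + 1) * u ^ (n + 1)‖ = (|q n| * |u|) * ‖a n * u ^ n‖ := by
        rw [ha, pow_succ]; simp only [norm_mul, Real.norm_eq_abs]; ring
    _ ≤ r * ‖a n * u ^ n‖ := by gcongr

lemma deriv_coeff_ratio {a q : ℕ → ℝ} (ha : ∀ n, a (n + 1) = q n * a n) (n : ℕ) :
    ((n + 1 : ℕ) + 1 : ℝ) * a (n + 1 + 1) =
      ((n + 2 : ℝ) / (n + 1) * q (n + 1)) * ((n + 1) * a (n + 1)) := by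
  rw [ha (n + 1)]
  have : (n + 1 : ℝ) ≠ 0 := by positivity
  push_cast
  field_simp
  ring

lemma tendsto_deriv_coeff_ratio {q : ℕ → ℝ} (hq : Tendsto q atTop (𝓝 1)) :
    Tendsto (fun n : ℕ => (n + 2 : ℝ) / (n + 1) * q (n + 1)) atTop (𝓝 1) := by
  have h : Tendsto (fun n : ℕ => (n + 2 : ℝ) / (n + 1)) atTop (𝓝 1) := by
    have := (tendsto_one_div_add_atTop_nhds_zero_nat (𝕜 := ℝ)).const_add 1
    rw [add_zero] at this
    refine this.congr fun n => ?_
    have : (n + 1 : ℝ) ≠ 0 := by positivity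
    field_simp
    ring
  simpa using h.mul (hq.comp (tendsto_add_atTop_nat 1))

/-- Termwise differentiation of a power series whose coefficient ratios tend to `1`. -/
lemma hasDerivAt_tsum_of_ratio {a q : ℕ → ℝ} (hq : Tendsto q atTop (𝓝 1))
    (ha : ∀ n, a (n + 1) = q n * a n) {u : ℝ} (hu : |u| < 1) :
    HasDerivAt (fun x => ∑' n, a n * x ^ n) (∑' n : ℕ, ((n + 1) * a (n + 1)) * u ^ n) u := by
  obtain ⟨r, hur, hr⟩ := exists_between hu
  have hr0 : 0 ≤ r := (abs_nonneg u).trans hur.le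
  have hsucc : Summable fun n : ℕ => ((n + 1) * a (n + 1)) * r ^ n :=
    summable_pow_of_ratio (a := fun n : ℕ => (n + 1) * a (n + 1))
      (tendsto_deriv_coeff_ratio hq) (deriv_coeff_ratio ha) (by rwa [abs_of_nonneg hr0])
  have hbound : Summable fun n : ℕ => ‖a n * (n * r ^ (n - 1))‖ := by
    rw [← summable_nat_add_iff 1]
    refine hsucc.norm.congr fun n => ?_
    rw [Nat.add_sub_cancel]
    push_cast
    congr 1
    ring
  have hmem : u ∈ Metric.ball (0 : ℝ) r := by simpa using hur
  have hterm : ∀ (n : ℕ), ∀ y ∈ Metric.ball (0 : ℝ) r,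
      ‖a n * (n * y ^ (n - 1))‖ ≤ ‖a n * (n * r ^ (n - 1))‖ := by
    intro n y hy
    have hy' : |y| ≤ |r| := by
      rw [abs_of_nonneg hr0]
      exact (by simpa using hy : |y| < r).le
    simp only [norm_mul, norm_pow, Real.norm_eq_abs]
    gcongr
  have hderiv := hasDerivAt_tsum_of_isPreconnected (g := fun n x => a n * x ^ n)
    hbound Metric.isOpen_ball (convex_ball (0 : ℝ) r).isPreconnected
    (fun n y _ => (hasDerivAt_pow n y).const_mul (a n)) hterm hmem
    (summable_pow_of_ratio hq ha hu) hmem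
  have hs : Summable fun n : ℕ => a n * (n * u ^ (n - 1)) :=
    Summable.of_norm_bounded hbound fun n => hterm n u hmem
  have hsum : ∑' n : ℕ, a n * (n * u ^ (n - 1)) = ∑' n : ℕ, ((n + 1) * a (n + 1)) * u ^ n := by
    rw [hs.tsum_eq_zero_add]
    simp only [Nat.cast_zero, zero_mul, mul_zero, zero_add]
    refine tsum_congr fun n => ?_
    rw [Nat.add_sub_cancel]
    push_cast
    ring
  exact hsum ▸ hderiv

lemma HasSum.mul_pow_shift {g : ℕ → ℝ} {u S : ℝ} (hg : g 0 = 0)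
    (h : HasSum (fun n => g (n + 1) * u ^ n) S) : HasSum (fun n => g n * u ^ n) (u * S) := by
  rw [← hasSum_nat_add_iff' 1]
  simpa [hg, pow_succ, mul_assoc, mul_comm, mul_left_comm] using h.mul_left u

/-- The coefficients of `phiHyp k μ`. -/
noncomputable def phiCoeff (k : ℕ) (μ : ℝ) (n : ℕ) : ℝ :=
  (∏ j ∈ Finset.range n, (((k : ℝ) / 2 + (j : ℝ)) ^ 2 + μ ^ 2)) /
    ((∏ j ∈ Finset.range n, (1 + (k : ℝ) + (j : ℝ))) * (n.factorial : ℝ))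

lemma phiHyp_eq_tsum (k : ℕ) (μ : ℝ) : phiHyp k μ = fun u => ∑' n, phiCoeff k μ n * u ^ n := by
  funext u
  refine tsum_congr fun n => ?_
  rw [phiCoeff, div_mul_eq_mul_div]

lemma phiCoeff_succ (k : ℕ) (μ : ℝ) (n : ℕ) :
    phiCoeff k μ (n + 1) =
      (((k : ℝ) / 2 + n) ^ 2 + μ ^ 2) / ((1 + k + n) * (n + 1)) * phiCoeff k μ n := by
  simp only [phiCoeff, Finset.prod_range_succ, Nat.factorial_succ, Nat.cast_mul, Nat.cast_succ]
  rw [div_mul_div_comm]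
  congr 1 <;> ring

lemma tendsto_phiCoeff_ratio (k : ℕ) (μ : ℝ) :
    Tendsto (fun n : ℕ => (((k : ℝ) / 2 + n) ^ 2 + μ ^ 2) / ((1 + k + n) * (n + 1)))
      atTop (𝓝 1) := by
  have hi : Tendsto (fun n : ℕ => (n : ℝ)⁻¹) atTop (𝓝 0) := tendsto_inv_atTop_nhds_zero_nat
  have hnum := (((hi.const_mul ((k : ℝ) / 2)).add_const 1).pow 2).add ((hi.pow 2).const_mul (μ ^ 2))
  have hden := ((hi.const_mul (1 + k : ℝ)).add_const 1).mul (hi.add_const 1)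
  have h := hnum.div hden (by norm_num)
  norm_num at h
  refine h.congr' ?_
  filter_upwards [eventually_gt_atTop 0] with n hn
  have hn' : (0 : ℝ) < n := by exact_mod_cast hn
  simp only [Pi.div_apply]
  field_simp
  ring

/-- The hypergeometric differential equation with parameters `k/2 ± iμ` and `1 + k`. -/
lemma phiHyp_ode (k : ℕ) (μ : ℝ) : ∃ φ₁ φ₂ : ℝ → ℝ, ∀ u : ℝ, |u| < 1 →
    HasDerivAt (phiHyp k μ) (φ₁ u) u ∧ HasDerivAt φ₁ (φ₂ u) u ∧
    u * (1 - u) * φ₂ u + (1 + k) * (1 - u) * φ₁ u - ((k : ℝ) ^ 2 / 4 + μ ^ 2) * phiHyp k μ u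
      = 0 := by
  have hq := tendsto_phiCoeff_ratio k μ
  have ha := phiCoeff_succ k μ
  set a := phiCoeff k μ
  have hq₁ := tendsto_deriv_coeff_ratio hq
  have ha₁ := deriv_coeff_ratio ha
  have hq₂ := tendsto_deriv_coeff_ratio hq₁
  have ha₂ := deriv_coeff_ratio (a := fun n : ℕ => ((n : ℝ) + 1) * a (n + 1)) ha₁
  refine ⟨fun u => ∑' n : ℕ, (((n : ℝ) + 1) * a (n + 1)) * u ^ n,
    fun u => ∑' n : ℕ, (((n : ℝ) + 1) * (((n + 1 : ℕ) + 1 : ℝ) * a (n + 1 + 1))) * u ^ n,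
    fun u hu => ⟨?_, ?_, ?_⟩⟩
  · rw [phiHyp_eq_tsum]
    exact hasDerivAt_tsum_of_ratio hq ha hu
  · exact hasDerivAt_tsum_of_ratio (a := fun n : ℕ => ((n : ℝ) + 1) * a (n + 1)) hq₁ ha₁ hu
  · rw [phiHyp_eq_tsum]
    have s₀ := (summable_pow_of_ratio hq ha hu).hasSum
    have s₁ := (summable_pow_of_ratio (a := fun n : ℕ => ((n : ℝ) + 1) * a (n + 1))
      hq₁ ha₁ hu).hasSum
    have s₂ := (summable_pow_of_ratio
      (a := fun n : ℕ => ((n : ℝ) + 1) * (((n + 1 : ℕ) + 1 : ℝ) * a (n + 1 + 1)))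
      hq₂ ha₂ hu).hasSum
    beta_reduce
    set S₀ := ∑' n, a n * u ^ n
    set S₁ := ∑' n : ℕ, (((n : ℝ) + 1) * a (n + 1)) * u ^ n
    set S₂ := ∑' n : ℕ, (((n : ℝ) + 1) * (((n + 1 : ℕ) + 1 : ℝ) * a (n + 1 + 1))) * u ^ n
    have t₁ : HasSum (fun n : ℕ => ((n : ℝ) * a n) * u ^ n) (u * S₁) :=
      HasSum.mul_pow_shift (by simp) (by simpa using s₁)
    have t₂ : HasSum (fun n : ℕ => ((n : ℝ) * ((n + 1) * a (n + 1))) * u ^ n) (u * S₂) :=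
      HasSum.mul_pow_shift (by simp) (by simpa using s₂)
    have t₃ : HasSum (fun n : ℕ => (((n : ℝ) - 1) * (n * a n)) * u ^ n) (u * (u * S₂)) :=
      HasSum.mul_pow_shift (by simp) (by simpa using t₂)
    have key := (((t₂.sub t₃).add ((s₁.sub t₁).mul_left (1 + k : ℝ))).sub
      (s₀.mul_left ((k : ℝ) ^ 2 / 4 + μ ^ 2)))
    have hterm : ∀ n : ℕ, (n : ℝ) * ((n + 1) * a (n + 1)) * u ^ n
        - ((n : ℝ) - 1) * (n * a n) * u ^ n
        + (1 + k : ℝ) * (((n : ℝ) + 1) * a (n + 1) * u ^ n - n * a n * u ^ n)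
        - ((k : ℝ) ^ 2 / 4 + μ ^ 2) * (a n * u ^ n) = 0 := by
      intro n
      rw [ha n]
      have h₁ : (n + 1 : ℝ) ≠ 0 := by positivity
      have h₂ : (1 + k + n : ℝ) ≠ 0 := by positivity
      field_simp
      ring
    simp only [hterm] at key
    have hzero := key.unique hasSum_zero
    linear_combination hzero

/-- For every real `d > 0`, every integer `k ≥ 0`, every real `μ`, and every `0 < u < 1`,
the function `H(u) = u^(k/2) · φ(u)` satisfies the hypergeometric-type ODE
`u(1−u)·H''(u) + (1−u)·H'(u) − (k²/4)·H(u)/u − μ²·H(u) = 0`. -/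
theorem Hhyp_ode (d : ℝ) (hd : 0 < d) (k : ℕ) (μ : ℝ) (u : ℝ) (hu0 : 0 < u) (hu1 : u < 1) :
    u * (1 - u) * deriv (deriv (Hhyp k μ)) u + (1 - u) * deriv (Hhyp k μ) u
      - ((k : ℝ) ^ 2 / 4) * Hhyp k μ u / u - μ ^ 2 * Hhyp k μ u = 0 := by
  obtain ⟨φ₁, φ₂, h⟩ := phiHyp_ode k μ
  set s : ℝ := (k : ℝ) / 2 with hs
  have hH : ∀ x ∈ Set.Ioo (0 : ℝ) 1,
      HasDerivAt (Hhyp k μ) (s * x ^ (s - 1) * phiHyp k μ x + x ^ s * φ₁ x) x := fun x hx =>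
    (Real.hasDerivAt_rpow_const (Or.inl hx.1.ne')).mul
      (h x (abs_lt.2 ⟨by linarith [hx.1], hx.2⟩)).1
  have hu : u ∈ Set.Ioo (0 : ℝ) 1 := ⟨hu0, hu1⟩
  obtain ⟨d₁, d₂, ode⟩ := h u (abs_lt.2 ⟨by linarith, hu1⟩)
  have hev : deriv (Hhyp k μ) =ᶠ[𝓝 u]
      fun x => s * x ^ (s - 1) * phiHyp k μ x + x ^ s * φ₁ x := by
    filter_upwards [isOpen_Ioo.mem_nhds hu] with x hx using (hH x hx).deriv
  have hH₂ := ((((Real.hasDerivAt_rpow_const (p := s - 1) (Or.inl hu0.ne')).const_mul s).mul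
    d₁).add ((Real.hasDerivAt_rpow_const (p := s) (Or.inl hu0.ne')).mul d₂)).congr_of_eventuallyEq
      hev
  rw [hH₂.deriv, (hH u hu).deriv, Hhyp, ← hs, Real.rpow_sub_one hu0.ne' (s - 1),
    Real.rpow_sub_one hu0.ne' s]
  have hk : (k : ℝ) = 2 * s := by rw [hs]; ring
  rw [hk] at ode ⊢
  field_simp
  linear_combination 4 * u ^ s * u * ode
end

section
/- For every real d > 0 and every u with 0 < u < 1, the strict inequality u · G_d(u) < F_d(u) · log(1/(1−u)) holds, where F_d(u) = ∑_{n=0}^∞ (∏_{j=0}^{n-1} (j² + d²)) · uⁿ / (n!)² and G_d(u) = ∑_{n=0}^∞ (∏_{j=1}^{n} (j² + d²)) · uⁿ / (n! · (n+1)!). Equivalently, in classical notation: ₂F₁(1+di, 1−di; 2; u) · u < ₂F₁(di, −di; 1; u) · log(1/(1−u)) for all d > 0 and 0 < u < 1. -/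
/-- The real-valued form of the Gauss hypergeometric function `₂F₁(di, −di; 1; u)`. -/
noncomputable def Fhyp (d : ℝ) (u : ℝ) : ℝ :=
  ∑' n : ℕ, (∏ j ∈ Finset.range n, ((j : ℝ) ^ 2 + d ^ 2)) * u ^ n / ((n.factorial : ℝ)) ^ 2

/-- The real-valued form of `₂F₁(1+di, 1−di; 2; u)`. -/
noncomputable def Ghyp (d : ℝ) (u : ℝ) : ℝ :=
  ∑' n : ℕ, (∏ j ∈ Finset.Icc 1 n, ((j : ℝ) ^ 2 + d ^ 2)) * u ^ n /
    ((n.factorial : ℝ) * ((n + 1).factorial : ℝ))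

/-- The power series coefficients of `Fhyp`. -/
noncomputable def FhypCoeff (d : ℝ) (n : ℕ) : ℝ :=
  (∏ j ∈ Finset.range n, ((j : ℝ) ^ 2 + d ^ 2)) / ((n.factorial : ℝ)) ^ 2

/-- The power series coefficients of `Ghyp`. -/
noncomputable def GhypCoeff (d : ℝ) (n : ℕ) : ℝ :=
  (∏ j ∈ Finset.Icc 1 n, ((j : ℝ) ^ 2 + d ^ 2)) / ((n.factorial : ℝ) * ((n + 1).factorial : ℝ))

theorem Fhyp_eq_tsum (d u : ℝ) : Fhyp d u = ∑' n, FhypCoeff d n * u ^ n := by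
  simp only [Fhyp, FhypCoeff, div_mul_eq_mul_div]

theorem Ghyp_eq_tsum (d u : ℝ) : Ghyp d u = ∑' n, GhypCoeff d n * u ^ n := by
  simp only [Ghyp, GhypCoeff, div_mul_eq_mul_div]

theorem FhypCoeff_pos {d : ℝ} (hd : 0 < d) (n : ℕ) : 0 < FhypCoeff d n :=
  div_pos (Finset.prod_pos fun _ _ => by positivity) (by positivity)

theorem FhypCoeff_succ (d : ℝ) (n : ℕ) :
    FhypCoeff d (n + 1) = FhypCoeff d n * (((n : ℝ) ^ 2 + d ^ 2) / ((n : ℝ) + 1) ^ 2) := by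
  rw [FhypCoeff, FhypCoeff, Finset.prod_range_succ, Nat.factorial_succ]
  push_cast
  rw [div_mul_div_comm, mul_pow, mul_comm (((n : ℝ) + 1) ^ 2)]

theorem GhypCoeff_succ (d : ℝ) (n : ℕ) :
    GhypCoeff d (n + 1) =
      GhypCoeff d n * ((((n : ℝ) + 1) ^ 2 + d ^ 2) / (((n : ℝ) + 1) * ((n : ℝ) + 2))) := by
  rw [GhypCoeff, GhypCoeff, Finset.prod_Icc_succ_top (by lia), Nat.factorial_succ (n + 1),
    Nat.factorial_succ n]
  have : (n.factorial : ℝ) ≠ 0 := by positivity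
  push_cast
  field_simp
  ring

/-- The derivative of the series of `Fhyp d` is `d ^ 2` times the series of `Ghyp d`. -/
theorem succ_mul_FhypCoeff_succ (d : ℝ) (n : ℕ) :
    ((n : ℝ) + 1) * FhypCoeff d (n + 1) = d ^ 2 * GhypCoeff d n := by
  induction n with
  | zero => simp [FhypCoeff, GhypCoeff]
  | succ n ih =>
    rw [FhypCoeff_succ, GhypCoeff_succ, ← mul_assoc (d ^ 2), ← ih]
    push_cast
    field_simp
    ring

theorem sum_FhypCoeff (d : ℝ) (n : ℕ) :
    ∑ k ∈ Finset.range (n + 1), FhypCoeff d k = ((n : ℝ) + 1) * GhypCoeff d n := by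
  induction n with
  | zero => simp [FhypCoeff, GhypCoeff]
  | succ n ih =>
    have h := succ_mul_FhypCoeff_succ d n
    have hF : FhypCoeff d (n + 1) = d ^ 2 * GhypCoeff d n / ((n : ℝ) + 1) := by
      field_simp
      linarith
    rw [Finset.sum_range_succ, ih, hF, GhypCoeff_succ]
    push_cast
    field_simp
    ring

theorem summable_FhypCoeff_mul_pow {d : ℝ} (hd : 0 < d) {u : ℝ} (hu0 : 0 < u) (hu1 : u < 1) :
    Summable fun n => FhypCoeff d n * u ^ n := by
  have hlim : Filter.Tendsto (fun n : ℕ => ((n : ℝ) ^ 2 + d ^ 2) / ((n : ℝ) + 1) ^ 2 * u)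
      Filter.atTop (nhds u) := by
    have h0 : Filter.Tendsto (fun n : ℕ => 1 / ((n : ℝ) + 1)) Filter.atTop (nhds 0) :=
      tendsto_one_div_add_atTop_nhds_zero_nat
    have h : Filter.Tendsto
        (fun n : ℕ => ((1 - 1 / ((n : ℝ) + 1)) ^ 2 + d ^ 2 * (1 / ((n : ℝ) + 1)) ^ 2) * u)
        Filter.atTop (nhds (((1 - 0) ^ 2 + d ^ 2 * 0 ^ 2) * u)) :=
      (((h0.const_sub 1).pow 2).add ((h0.pow 2).const_mul _)).mul_const u
    convert h using 2
    · field_simp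
      ring
    · ring
  refine summable_of_ratio_test_tendsto_lt_one hu1
    (Filter.Eventually.of_forall fun n => (mul_pos (FhypCoeff_pos hd n) (by positivity)).ne') ?_
  refine hlim.congr fun n => ?_
  have hF := FhypCoeff_pos hd n
  have hF' := FhypCoeff_pos hd (n + 1)
  rw [Real.norm_of_nonneg (by positivity), Real.norm_of_nonneg (by positivity), FhypCoeff_succ]
  field_simp
  ring

/-- For every `d > 0` and every `0 < u < 1`, the strict inequality
`₂F₁(1+di, 1−di; 2; u) · u < ₂F₁(di, −di; 1; u) · log(1/(1−u))` holds. -/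
theorem Ghyp_mul_lt_Fhyp_mul_log (d : ℝ) (hd : 0 < d) (u : ℝ) (hu0 : 0 < u) (hu1 : u < 1) :
    u * Ghyp d u < Fhyp d u * Real.log (1 / (1 - u)) := by
  set L : ℕ → ℝ := fun n => u ^ (n + 1) / ((n : ℝ) + 1)
  have hL : HasSum L (-Real.log (1 - u)) :=
    Real.hasSum_pow_div_log_of_abs_lt_one (by rwa [abs_of_pos hu0])
  have hF := summable_FhypCoeff_mul_pow hd hu0 hu1
  have hprod : Fhyp d u * Real.log (1 / (1 - u)) =
      ∑' n, ∑ k ∈ Finset.range (n + 1), FhypCoeff d k * u ^ k * L (n - k) := by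
    rw [one_div, Real.log_inv, ← hL.tsum_eq, Fhyp_eq_tsum]
    exact tsum_mul_tsum_eq_tsum_sum_range_of_summable_norm hF.norm hL.summable.norm
  have hsum : Summable fun n => ∑ k ∈ Finset.range (n + 1), FhypCoeff d k * u ^ k * L (n - k) :=
    (summable_norm_sum_mul_range_of_summable_norm hF.norm hL.summable.norm).of_norm
  have hterm (n k : ℕ) (hk : k ≤ n) :
      FhypCoeff d k * u ^ k * L (n - k) = FhypCoeff d k * u ^ (n + 1) / ((n : ℝ) - k + 1) := by
    have hpow : u ^ (n + 1) = u ^ k * u ^ (n - k + 1) := by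
      rw [← pow_add]
      congr 1
      lia
    simp only [L]
    rw [Nat.cast_sub hk, hpow]
    ring
  have hG (n : ℕ) : u * (GhypCoeff d n * u ^ n) =
      ∑ k ∈ Finset.range (n + 1), FhypCoeff d k * u ^ (n + 1) / ((n : ℝ) + 1) := by
    rw [← Finset.sum_div, ← Finset.sum_mul, sum_FhypCoeff]
    field_simp
    ring
  have hle_term (n k : ℕ) (hk : k ∈ Finset.range (n + 1)) :
      FhypCoeff d k * u ^ (n + 1) / ((n : ℝ) + 1) ≤ FhypCoeff d k * u ^ k * L (n - k) := by
    have hkn : k ≤ n := Finset.mem_range_succ_iff.mp hk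
    have hkn' : (k : ℝ) ≤ n := mod_cast hkn
    have hpos := FhypCoeff_pos hd k
    rw [hterm n k hkn]
    exact div_le_div_of_nonneg_left (by positivity) (by linarith)
      (by linarith [(Nat.cast_nonneg k : (0 : ℝ) ≤ k)])
  have hle (n : ℕ) : u * (GhypCoeff d n * u ^ n) ≤
      ∑ k ∈ Finset.range (n + 1), FhypCoeff d k * u ^ k * L (n - k) := by
    rw [hG]
    exact Finset.sum_le_sum (hle_term n)
  have hlt : u * (GhypCoeff d 1 * u ^ 1) <
      ∑ k ∈ Finset.range (1 + 1), FhypCoeff d k * u ^ k * L (1 - k) := by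
    rw [hG]
    refine Finset.sum_lt_sum (hle_term 1) ⟨1, by simp, ?_⟩
    have hpos := FhypCoeff_pos hd 1
    rw [hterm 1 1 le_rfl]
    exact div_lt_div_of_pos_left (by positivity) (by norm_num) (by norm_num)
  have hnonneg (n : ℕ) : 0 ≤ u * (GhypCoeff d n * u ^ n) := by
    rw [hG]
    exact Finset.sum_nonneg fun k _ => by
      have := FhypCoeff_pos hd k
      positivity
  rw [hprod, Ghyp_eq_tsum, ← tsum_mul_left]
  exact (Summable.of_nonneg_of_le hnonneg hle hsum).tsum_lt_tsum hle hlt hsum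
end

section
/- For every real d > 0, the ratio u · G_d(u) / (F_d(u) · log(1/(1−u))) tends to 1 as u tends to 1 from the left, where F_d(u) = ∑_{n=0}^∞ (∏_{j=0}^{n-1} (j² + d²)) · uⁿ / (n!)² and G_d(u) = ∑_{n=0}^∞ (∏_{j=1}^{n} (j² + d²)) · uⁿ / (n! · (n+1)!). In other words, the inequality u · G_d(u) < F_d(u) · log(1/(1−u)) is asymptotically sharp as u → 1⁻. -/
open Filter Topology Finset in
/-- A logarithmic Abelian theorem: if `p n → P`, then `∑ p n * u ^ (n + 1) / (n + 1)` is
asymptotic to `-P * log (1 - u)` as `u → 1⁻`. -/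
theorem tendsto_tsum_mul_pow_div_div_neg_log {p : ℕ → ℝ} {P : ℝ}
    (hp : Tendsto p atTop (𝓝 P)) :
    Tendsto (fun u : ℝ => (∑' n : ℕ, p n * (u ^ (n + 1) / ((n : ℝ) + 1))) / -Real.log (1 - u))
      (𝓝[<] 1) (𝓝 P) := by
  have hlog : Tendsto (fun u : ℝ => -Real.log (1 - u)) (𝓝[<] 1) atTop := by
    refine tendsto_neg_atBot_atTop.comp (Real.tendsto_log_nhdsGT_zero.comp ?_)
    refine tendsto_nhdsWithin_of_tendsto_nhds_of_eventually_within _ ?_ ?_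
    · have : Tendsto (fun u : ℝ => 1 - u) (𝓝 1) (𝓝 (1 - 1)) :=
        tendsto_const_nhds.sub tendsto_id
      rw [sub_self] at this
      exact this.mono_left nhdsWithin_le_nhds
    · filter_upwards [self_mem_nhdsWithin] with u hu
      exact sub_pos.2 (Set.mem_Iio.1 hu)
  rw [Metric.tendsto_nhds]
  intro ε hε
  obtain ⟨N, hN⟩ := Metric.tendsto_atTop.1 hp (ε / 2) (half_pos hε)
  have hunit : ∀ᶠ u : ℝ in 𝓝[<] 1, u ∈ Set.Ioo (0 : ℝ) 1 :=
    Ioo_mem_nhdsLT one_pos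
  filter_upwards [hunit, hlog.eventually_gt_atTop 0,
    hlog.eventually_gt_atTop ((∑ n ∈ range N, |p n - P|) / (ε / 2))] with u hu hL hLN
  rw [div_lt_iff₀ (half_pos hε)] at hLN
  set w : ℕ → ℝ := fun n => u ^ (n + 1) / ((n : ℝ) + 1) with hw
  have hw0 : ∀ n, 0 ≤ w n := fun n => by have := hu.1; positivity
  have hw1 : ∀ n, w n ≤ 1 := fun n =>
    div_le_one_of_le₀ ((pow_le_one₀ hu.1.le hu.2.le).trans (by simp)) (by positivity)
  have hsum : HasSum w (-Real.log (1 - u)) :=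
    Real.hasSum_pow_div_log_of_abs_lt_one (abs_lt.2 ⟨by linarith [hu.1], hu.2⟩)
  set r : ℕ → ℝ := fun n => if n ∈ range N then |p n - P| else 0 with hr
  have hrsum : HasSum r (∑ n ∈ range N, |p n - P|) := by
    have h : HasSum r (∑ n ∈ range N, r n) :=
      hasSum_sum_of_ne_finset_zero fun n hn => if_neg hn
    rwa [sum_congr rfl fun n hn => if_pos hn] at h
  have hbound : ∀ n, ‖(p n - P) * w n‖ ≤ ε / 2 * w n + r n := by
    intro n
    rw [Real.norm_eq_abs, abs_mul, abs_of_nonneg (hw0 n)]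
    by_cases hn : n ∈ range N
    · simp only [hr, if_pos hn]
      have h1 := mul_le_of_le_one_right (abs_nonneg (p n - P)) (hw1 n)
      have h2 := mul_nonneg (half_pos hε).le (hw0 n)
      linarith
    · simp only [hr, if_neg hn, add_zero]
      exact mul_le_mul_of_nonneg_right
        (hN n (not_lt.1 fun h => hn (mem_range.2 h))).le (hw0 n)
  have hmaj := (hsum.mul_left (ε / 2)).add hrsum
  have hdiff : Summable fun n => (p n - P) * w n :=
    Summable.of_norm_bounded hmaj.summable hbound
  have hle := tsum_of_norm_bounded hmaj hbound
  have hsplit : ∑' n, p n * w n = (∑' n, (p n - P) * w n) + P * -Real.log (1 - u) := by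
    rw [← (hdiff.hasSum.add (hsum.mul_left P)).tsum_eq]
    exact tsum_congr fun n => by ring
  rw [Real.dist_eq, hsplit, add_div, mul_div_cancel_right₀ _ hL.ne', add_sub_cancel_right,
    abs_div, abs_of_pos hL, div_lt_iff₀ hL]
  rw [Real.norm_eq_abs] at hle
  linarith

theorem prod_range_succ_sq_add_sq (d : ℝ) (n : ℕ) :
    ∏ j ∈ Finset.range n, (((j : ℝ) + 1) ^ 2 + d ^ 2) =
      (∏ j ∈ Finset.range n, (1 + d ^ 2 / ((j : ℝ) + 1) ^ 2)) * (n.factorial : ℝ) ^ 2 := by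
  induction n with
  | zero => simp
  | succ n ih =>
    rw [Finset.prod_range_succ, Finset.prod_range_succ, ih, Nat.factorial_succ]
    push_cast
    field_simp

/-- The partial sums of the coefficients of `Fhyp d` are the partial products of
`∏ (1 + d ^ 2 / j ^ 2)`. -/
theorem sum_range_Fhyp_coeff (d : ℝ) (n : ℕ) :
    ∑ i ∈ Finset.range (n + 1),
        (∏ j ∈ Finset.range i, ((j : ℝ) ^ 2 + d ^ 2)) / (i.factorial : ℝ) ^ 2 =
      ∏ j ∈ Finset.range n, (1 + d ^ 2 / ((j : ℝ) + 1) ^ 2) := by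
  induction n with
  | zero => simp
  | succ n ih =>
    rw [Finset.sum_range_succ, ih, Finset.prod_range_succ', Finset.prod_range_succ]
    push_cast
    rw [prod_range_succ_sq_add_sq, Nat.factorial_succ]
    have : (n.factorial : ℝ) ≠ 0 := by positivity
    push_cast
    field_simp
    ring

theorem mul_Ghyp_eq_tsum (d u : ℝ) :
    u * Ghyp d u = ∑' n : ℕ, (∏ j ∈ Finset.range n, (1 + d ^ 2 / ((j : ℝ) + 1) ^ 2)) *
      (u ^ (n + 1) / ((n : ℝ) + 1)) := by
  rw [Ghyp, ← tsum_mul_left]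
  refine tsum_congr fun n => ?_
  have h : ∏ j ∈ Finset.Icc 1 n, ((j : ℝ) ^ 2 + d ^ 2) =
      ∏ j ∈ Finset.range n, (((j : ℝ) + 1) ^ 2 + d ^ 2) := by
    rw [Finset.range_eq_Ico, ← Finset.Ico_add_one_right_eq_Icc]
    simpa using (Finset.prod_Ico_add' (fun j : ℕ => (j : ℝ) ^ 2 + d ^ 2) 0 n 1).symm
  rw [h, prod_range_succ_sq_add_sq, Nat.factorial_succ]
  have : (n.factorial : ℝ) ≠ 0 := by positivity
  push_cast
  field_simp
  ring

open Filter Topology in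
theorem exists_tendsto_prod_one_add_sq_div_sq (d : ℝ) :
    ∃ P : ℝ, 0 < P ∧
      Tendsto (fun n => ∏ j ∈ Finset.range n, (1 + d ^ 2 / ((j : ℝ) + 1) ^ 2)) atTop (𝓝 P) := by
  have hs : Summable fun j : ℕ => d ^ 2 / ((j : ℝ) + 1) ^ 2 := by
    have h := (summable_nat_add_iff 1).2 (Real.summable_one_div_nat_pow.2 one_lt_two)
    simpa [div_eq_mul_inv] using h.mul_left (d ^ 2)
  have ht := (Real.multipliable_one_add_of_summable hs).hasProd.tendsto_prod_nat
  refine ⟨_, one_pos.trans_le (ge_of_tendsto' ht fun n => ?_), ht⟩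
  exact Finset.one_le_prod fun j _ => le_add_of_nonneg_right (by positivity)

open Filter Topology in
theorem tendsto_Fhyp_nhdsLT_one {d P : ℝ}
    (hP : Tendsto (fun n => ∏ j ∈ Finset.range n, (1 + d ^ 2 / ((j : ℝ) + 1) ^ 2))
      atTop (𝓝 P)) :
    Tendsto (Fhyp d) (𝓝[<] 1) (𝓝 P) := by
  have h : Tendsto (fun n => ∑ i ∈ Finset.range n,
      (∏ j ∈ Finset.range i, ((j : ℝ) ^ 2 + d ^ 2)) / (i.factorial : ℝ) ^ 2) atTop (𝓝 P) := by
    rw [← tendsto_add_atTop_iff_nat 1]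
    simpa only [sum_range_Fhyp_coeff] using hP
  refine (Real.tendsto_tsum_powerSeries_nhdsWithin_lt h).congr fun u => ?_
  exact tsum_congr fun n => by ring

/-- For every `d > 0`, the ratio `u · G_d(u) / (F_d(u) · log(1/(1−u)))` tends to `1`
as `u → 1⁻`: the inequality `u · G_d(u) < F_d(u) · log(1/(1−u))` is asymptotically sharp. -/
theorem Ghyp_div_Fhyp_log_tendsto_one (d : ℝ) (hd : 0 < d) :
    Filter.Tendsto (fun u : ℝ => u * Ghyp d u / (Fhyp d u * Real.log (1 / (1 - u))))
      (nhdsWithin 1 (Set.Iio 1)) (nhds 1) := by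
  obtain ⟨P, hP0, hP⟩ := exists_tendsto_prod_one_add_sq_div_sq d
  have h := (tendsto_tsum_mul_pow_div_div_neg_log hP).div (tendsto_Fhyp_nhdsLT_one hP) hP0.ne'
  rw [div_self hP0.ne'] at h
  refine h.congr fun u => ?_
  simp only [Pi.div_apply]
  rw [← mul_Ghyp_eq_tsum, one_div, Real.log_inv, div_div, mul_comm (Fhyp d u)]
end

section
/- Let R > 0 and let h : ℝ → ℝ be continuous on [0, R], differentiable on (0, R), and suppose that for every r ∈ (0, R) the function r ↦ h'(r) · sinh(2r) has derivative 0 at r. Then h is constant on [0, R]. -/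
open Set Filter Topology in
/-- The radial harmonic function `log (sinh r / cosh r)` diverges at the core geodesic. -/
lemma tendsto_log_sinh_sub_log_cosh_atBot :
    Tendsto (fun r : ℝ => Real.log (Real.sinh r) - Real.log (Real.cosh r)) (𝓝[>] 0) atBot := by
  have hsinh : Tendsto Real.sinh (𝓝[>] 0) (𝓝[>] 0) := by
    refine tendsto_nhdsWithin_iff.2 ⟨?_, ?_⟩
    · simpa using (Real.continuous_sinh.tendsto 0).mono_left nhdsWithin_le_nhds
    · filter_upwards [self_mem_nhdsWithin] with r hr using Real.sinh_pos_iff.2 hr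
  refine tendsto_atBot_mono (fun r => ?_) (Real.tendsto_log_nhdsGT_zero.comp hsinh)
  have := Real.log_nonneg (Real.one_le_cosh r)
  simp only [Function.comp_apply]
  linarith

lemma hasDerivAt_log_sinh_sub_log_cosh {r : ℝ} (hr : 0 < r) :
    HasDerivAt (fun r : ℝ => Real.log (Real.sinh r) - Real.log (Real.cosh r))
      (2 / Real.sinh (2 * r)) r := by
  have hs : Real.sinh r ≠ 0 := (Real.sinh_pos_iff.2 hr).ne'
  have hc : Real.cosh r ≠ 0 := (Real.cosh_pos r).ne'
  refine (((Real.hasDerivAt_sinh r).log hs).sub ((Real.hasDerivAt_cosh r).log hc)).congr_deriv ?_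
  rw [Real.sinh_two_mul]
  field_simp
  linarith [Real.cosh_sq r]

/-- Let `R > 0` and let `h : ℝ → ℝ` be continuous on `[0, R]`, differentiable on `(0, R)`,
such that for every `r ∈ (0, R)` the function `r ↦ h'(r) · sinh(2r)` has derivative `0` at `r`.
Then `h` is constant on `[0, R]`. -/
theorem constant_of_radial_ode (R : ℝ) (hR : 0 < R) (h : ℝ → ℝ)
    (hcont : ContinuousOn h (Set.Icc 0 R))
    (hdiff : DifferentiableOn ℝ h (Set.Ioo 0 R))
    (hode : ∀ r ∈ Set.Ioo (0 : ℝ) R,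
      HasDerivAt (fun r : ℝ => deriv h r * Real.sinh (2 * r)) 0 r) :
    ∀ x ∈ Set.Icc (0 : ℝ) R, ∀ y ∈ Set.Icc (0 : ℝ) R, h x = h y := by
  obtain ⟨c, hc⟩ := isOpen_Ioo.exists_is_const_of_deriv_eq_zero isPreconnected_Ioo
    (fun r hr => (hode r hr).differentiableAt.differentiableWithinAt)
    (fun r hr => (hode r hr).deriv)
  have hgderiv : ∀ r ∈ Set.Ioo (0 : ℝ) R, HasDerivAt
      (fun r => h r - c / 2 * (Real.log (Real.sinh r) - Real.log (Real.cosh r))) 0 r := by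
    intro r hr
    have hs : Real.sinh (2 * r) ≠ 0 :=
      (Real.sinh_pos_iff.2 (mul_pos two_pos hr.1)).ne'
    refine (((hdiff.differentiableAt (isOpen_Ioo.mem_nhds hr)).hasDerivAt).sub
      ((hasDerivAt_log_sinh_sub_log_cosh hr.1).const_mul (c / 2))).congr_deriv ?_
    rw [← hc r hr]
    field_simp
    ring
  obtain ⟨d, hd⟩ := isOpen_Ioo.exists_is_const_of_deriv_eq_zero isPreconnected_Ioo
    (fun r hr => (hgderiv r hr).differentiableAt.differentiableWithinAt)
    (fun r hr => (hgderiv r hr).deriv)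
  have hc0 : c = 0 := by
    by_contra hne
    have hlim : Filter.Tendsto h (nhdsWithin 0 (Set.Ioi 0)) (nhds (h 0)) := by
      rw [← nhdsWithin_Ioo_eq_nhdsGT hR]
      exact (hcont 0 ⟨le_rfl, hR.le⟩).mono Set.Ioo_subset_Icc_self
    refine not_tendsto_nhds_of_tendsto_atBot tendsto_log_sinh_sub_log_cosh_atBot
      ((h 0 - d) / (c / 2)) (((hlim.sub_const d).div_const (c / 2)).congr' ?_)
    filter_upwards [Ioo_mem_nhdsGT hR] with r hr
    rw [← hd r hr]
    field_simp
    ring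
  have hderiv : ∀ r ∈ Set.Ioo (0 : ℝ) R, deriv h r = 0 := fun r hr =>
    (mul_eq_zero.1 ((hc r hr).trans hc0)).resolve_right
      (Real.sinh_pos_iff.2 (mul_pos two_pos hr.1)).ne'
  have hlt : ∀ x ∈ Set.Icc (0 : ℝ) R, ∀ y ∈ Set.Icc (0 : ℝ) R, x < y → h x = h y := by
    intro x hx y hy hxy
    have hsub : Set.Ioo x y ⊆ Set.Ioo 0 R := Set.Ioo_subset_Ioo hx.1 hy.2
    obtain ⟨z, hz, hslope⟩ := exists_deriv_eq_slope h hxy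
      (hcont.mono (Set.Icc_subset_Icc hx.1 hy.2)) (hdiff.mono hsub)
    rw [hderiv z (hsub hz), eq_comm, div_eq_zero_iff] at hslope
    rcases hslope with h0 | h0 <;> linarith
  intro x hx y hy
  rcases lt_trichotomy x y with hxy | rfl | hxy
  · exact hlt x hx y hy hxy
  · rfl
  · exact (hlt y hy x hx hxy).symm
end
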